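/- Let P = (X, d, x̄) and S = (X, d, ȳ) be presentations of a Polish space X with the same complete compatible metric d. Then φ_P(F) ≤ ω·φ_S(F) + 2 (ordinal arithmetic) for every countable closed F ⊆ X. -/

import Mathlib

open Set Filter Topology

/-- A presentation `(X, d, x̄)` of a Polish space `X`: a complete metric `d`
compatible with the topology of `X`, together with a dense sequence `x̄`. -/
structure Presentation (X : Type) [TopologicalSpace X] where
  dist : X → X → ℝ
  seq : ℕ → X
  dist_self : ∀ x, dist x x = 0
  eq_of_dist_eq_zero : ∀ x y, dist x y = 0 → x = y
  dist_comm : ∀ x y, dist x y = dist y x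
  dist_triangle : ∀ x y z, dist x z ≤ dist x y + dist y z
  /-- `d` is compatible with the topology of `X`. -/
  isOpen_iff : ∀ s : Set X, IsOpen s ↔ ∀ x ∈ s, ∃ ε > 0, ∀ y, dist y x < ε → y ∈ s
  /-- `d` is complete. -/
  complete : ∀ u : ℕ → X, (∀ ε > 0, ∃ N, ∀ m ≥ N, ∀ n ≥ N, dist (u m) (u n) < ε) →
      ∃ x, ∀ ε > 0, ∃ N, ∀ n ≥ N, dist (u n) x < ε
  /-- the sequence `x̄` is dense. -/
  dense : ∀ x, ∀ ε > 0, ∃ i, dist x (seq i) < ε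

namespace Presentation

variable {X : Type} [TopologicalSpace X] (P : Presentation X)

/-- The open ball `B_P(n)`. -/
def ball (n : ℕ × ℕ) : Set X := {x | P.dist x (P.seq n.1) < (1/2 : ℝ) ^ (n.2 + 1)}

/-- The closed ball `B̄_P(n)`. -/
def cball (n : ℕ × ℕ) : Set X := {x | P.dist x (P.seq n.1) ≤ (1/2 : ℝ) ^ (n.2 + 1)}

/-- The relation `n ≺_P m`. -/
def prec (n m : ℕ × ℕ) : Prop := n.2 < m.2 ∧ P.cball m ⊆ P.ball n

/-- The relation `n ⋏_P m`. -/
def apart (n m : ℕ × ℕ) : Prop := P.cball n ∩ P.cball m = ∅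

/-- The code `A_F^P` of a closed set `F ⊆ X`. -/
def code (F : Set X) : Set (ℕ × ℕ) := {n | (P.ball n ∩ F).Nonempty}

/-- The derivative `D_P` on subsets of `ω × ω`. -/
def deriv (A : Set (ℕ × ℕ)) : Set (ℕ × ℕ) :=
  {n ∈ A | ∃ u ∈ A, ∃ v ∈ A, P.prec n u ∧ P.prec n v ∧ P.apart u v}

/-- The transfinite iterates `D_P^α(A)`. -/
noncomputable def derivIter (A : Set (ℕ × ℕ)) (α : Ordinal.{0}) : Set (ℕ × ℕ) :=
  Ordinal.limitRecOn α A (fun _ ih => P.deriv ih)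
    (fun o _ ih => ⋂ (β : {β : Ordinal.{0} // β < o}), ih β.1 β.2)

/-- The rank `|A|_P`: the least ordinal `α` with `D_P^α(A) = D_P^{α+1}(A)`. -/
noncomputable def rankA (A : Set (ℕ × ℕ)) : Ordinal.{0} :=
  sInf {α | P.derivIter A (α + 1) = P.derivIter A α}

/-- The rank `φ_P(F) = |A_F^P|_P` of a (countable closed) subset `F ⊆ X`. -/
noncomputable def phi (F : Set X) : Ordinal.{0} := P.rankA (P.code F)

/-- `A ⊆ ω × ω` is `P`-closed. -/
def PClosed (A : Set (ℕ × ℕ)) : Prop := ∀ n ∈ A, ∀ m, P.prec m n → m ∈ A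

/-- `A ⊆ ω × ω` is `P`-pruned. -/
def PPruned (A : Set (ℕ × ℕ)) : Prop := ∀ n ∈ A, ∃ m ∈ A, P.prec n m

/-- `A ⊆ ω × ω` is `P`-perfect. -/
def PPerfect (A : Set (ℕ × ℕ)) : Prop :=
  ∀ n ∈ A, ∃ u ∈ A, ∃ v ∈ A, P.prec n u ∧ P.prec n v ∧ P.apart u v

/-- The set `[A]_P` of `P`-compatible sequences lying in `A`. -/
def body (A : Set (ℕ × ℕ)) : Set (ℕ → ℕ × ℕ) :=
  {f | (∀ i, P.prec (f i) (f (i + 1))) ∧ ∀ i, f i ∈ A}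

/-- The set `F_A^P = π_P([A]_P)`: the points obtained as the unique point of
`⋂_i B_P(n_i)` for a `P`-compatible sequence `(n_i)` in `A`. -/
def limitSet (A : Set (ℕ × ℕ)) : Set X :=
  {x | ∃ f ∈ P.body A, ∀ i, x ∈ P.ball (f i)}

end Presentation

section CB

variable {X : Type} [TopologicalSpace X]

/-- The Cantor–Bendixson derivative: the set of limit points of `F` in `F`. -/
def cbDeriv (F : Set X) : Set X := {x ∈ F | AccPt x (𝓟 F)}

/-- The iterated Cantor–Bendixson derivatives `F^α`. -/
noncomputable def cbIter (F : Set X) (α : Ordinal.{0}) : Set X :=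
  Ordinal.limitRecOn α F (fun _ ih => cbDeriv ih)
    (fun o _ ih => ⋂ (β : {β : Ordinal.{0} // β < o}), ih β.1 β.2)

/-- The Cantor–Bendixson rank `|F|_CB`. -/
noncomputable def cbRank (F : Set X) : Ordinal.{0} :=
  sInf {α | cbIter F (α + 1) = cbIter F α}

/-- The `K_σ`-derivative of a subset `A ⊆ X`: the points of `A` having no open
neighborhood in the subspace `A` whose closure in `A` is compact. -/
def kDeriv (A : Set X) : Set X :=
  {x ∈ A | ∀ U : Set X, IsOpen U → x ∈ U → ¬ IsCompact (A ∩ closure (U ∩ A))}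

/-- The iterated `K_σ`-derivatives `X_α` of the space `X`. -/
noncomputable def kIter (X : Type) [TopologicalSpace X] (α : Ordinal.{0}) : Set X :=
  Ordinal.limitRecOn α Set.univ (fun _ ih => kDeriv ih)
    (fun o _ ih => ⋂ (β : {β : Ordinal.{0} // β < o}), ih β.1 β.2)

/-- The `K_σ`-rank `|X|_{K_σ}`. -/
noncomputable def kRank (X : Type) [TopologicalSpace X] : Ordinal.{0} :=
  sInf {α | kIter X (α + 1) = kIter X α}

end CB

namespace Presentation

variable {X : Type} [TopologicalSpace X] (P : Presentation X)

theorem mem_ball {n : ℕ × ℕ} {x : X} :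
    x ∈ P.ball n ↔ P.dist x (P.seq n.1) < (1 / 2 : ℝ) ^ (n.2 + 1) := Iff.rfl

theorem mem_cball {n : ℕ × ℕ} {x : X} :
    x ∈ P.cball n ↔ P.dist x (P.seq n.1) ≤ (1 / 2 : ℝ) ^ (n.2 + 1) := Iff.rfl

theorem derivIter_zero (A : Set (ℕ × ℕ)) : P.derivIter A 0 = A := by
  simp [derivIter]

theorem derivIter_add_one (A : Set (ℕ × ℕ)) (α : Ordinal.{0}) :
    P.derivIter A (α + 1) = P.deriv (P.derivIter A α) := by
  simp [derivIter]

theorem derivIter_limit (A : Set (ℕ × ℕ)) {α : Ordinal.{0}} (h : Order.IsSuccLimit α) :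
    P.derivIter A α = ⋂ β : {β : Ordinal.{0} // β < α}, P.derivIter A β.1 :=
  Ordinal.limitRecOn_limit _ _ _ _ h

theorem derivIter_antitone (A : Set (ℕ × ℕ)) : Antitone (P.derivIter A) := by
  intro α β h
  induction β using Ordinal.limitRecOn with
  | zero => rw [le_antisymm h zero_le]
  | add_one β ih =>
    rcases h.eq_or_lt with rfl | h
    · exact le_rfl
    · rw [P.derivIter_add_one]
      exact fun n hn => ih (Order.lt_add_one_iff.1 h) hn.1
  | limit β hβ ih =>
    rcases h.eq_or_lt with rfl | h
    · exact le_rfl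
    · rw [P.derivIter_limit A hβ]
      exact iInter_subset (fun γ : {γ : Ordinal.{0} // γ < β} => P.derivIter A γ.1) ⟨α, h⟩

theorem exists_derivIter_stable (A : Set (ℕ × ℕ)) :
    ∃ α, P.derivIter A (α + 1) = P.derivIter A α := by
  by_contra! h
  refine not_injective_of_ordinal (P.derivIter A) (StrictAnti.injective ?_)
  intro α β hαβ
  refine lt_of_le_of_lt (P.derivIter_antitone A (Order.add_one_le_of_lt hαβ)) ?_
  exact lt_of_le_of_ne (P.derivIter_antitone A (Order.le_succ α)) (h α)

theorem derivIter_rankA_add_one (A : Set (ℕ × ℕ)) :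
    P.derivIter A (P.rankA A + 1) = P.derivIter A (P.rankA A) :=
  csInf_mem (s := {α | P.derivIter A (α + 1) = P.derivIter A α}) (P.exists_derivIter_stable A)

theorem rankA_le_of_derivIter_eq_empty {A : Set (ℕ × ℕ)} {α : Ordinal.{0}}
    (h : P.derivIter A α = ∅) : P.rankA A ≤ α := by
  refine csInf_le' ?_
  have := P.derivIter_antitone A (Order.le_succ α)
  rw [h] at this
  exact (subset_empty_iff.1 this).trans h.symm

theorem ball_subset_cball (n : ℕ × ℕ) : P.ball n ⊆ P.cball n := fun _ hx =>
  P.mem_cball.2 (P.mem_ball.1 hx).le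

theorem seq_mem_cball (n : ℕ × ℕ) : P.seq n.1 ∈ P.cball n := by
  rw [P.mem_cball, P.dist_self]
  positivity

theorem exists_half_pow_lt {ε : ℝ} (hε : 0 < ε) : ∃ N : ℕ, ∀ n ≥ N, (1 / 2 : ℝ) ^ n < ε := by
  obtain ⟨N, hN⟩ := exists_pow_lt_of_lt_one hε (by norm_num : (1 / 2 : ℝ) < 1)
  exact ⟨N, fun n hn => (pow_le_pow_of_le_one (by norm_num) (by norm_num) hn).trans_lt hN⟩

/-- Closed balls contain the limits of their sequences. -/
theorem mem_cball_of_tendsto {n : ℕ × ℕ} {a : ℕ → X} {z : X} {N : ℕ}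
    (ha : ∀ i ≥ N, a i ∈ P.cball n) (hz : ∀ ε > 0, ∃ N, ∀ i ≥ N, P.dist (a i) z < ε) :
    z ∈ P.cball n := by
  refine P.mem_cball.2 (le_of_forall_pos_le_add fun ε hε => ?_)
  obtain ⟨M, hM⟩ := hz ε hε
  have h₁ := hM (max M N) (le_max_left _ _)
  have h₂ : P.dist _ _ ≤ _ := ha (max M N) (le_max_right _ _)
  have h₃ := P.dist_triangle z (a (max M N)) (P.seq n.1)
  rw [P.dist_comm z (a _)] at h₃
  linarith

/-- The closed balls along a `P`-compatible sequence have a common point. -/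
theorem exists_mem_cball_of_prec {c : ℕ → ℕ × ℕ} (hc : ∀ i, P.prec (c i) (c (i + 1))) :
    ∃ z, ∀ i, z ∈ P.cball (c i) := by
  have hanti : Antitone fun i => P.cball (c i) :=
    antitone_nat_of_succ_le fun i => (hc i).2.trans (P.ball_subset_cball _)
  have hrad : ∀ i, i ≤ (c i).2 := fun i =>
    (strictMono_nat_of_lt_succ fun i => (hc i).1 : StrictMono fun i => (c i).2).le_apply
  have hmem : ∀ i, ∀ j ≥ i, P.seq (c j).1 ∈ P.cball (c i) := fun i j hj =>
    hanti hj (P.seq_mem_cball _)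
  obtain ⟨z, hz⟩ := P.complete (fun i => P.seq (c i).1) (by
    intro ε hε
    obtain ⟨N, hN⟩ := exists_half_pow_lt hε
    refine ⟨N, fun m hm n hn => ?_⟩
    have h₁ : P.dist _ _ ≤ _ := hmem N m hm
    have h₂ : P.dist _ _ ≤ _ := hmem N n hn
    have h₃ := P.dist_triangle (P.seq (c m).1) (P.seq (c N).1) (P.seq (c n).1)
    rw [P.dist_comm (P.seq (c N).1)] at h₃
    have h₄ := hN _ (hrad N)
    rw [pow_succ] at h₁ h₂
    linarith)
  exact ⟨z, fun i => P.mem_cball_of_tendsto (hmem i) hz⟩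

/-- A `P`-perfect set of codes meeting a closed set `F` forces `F` to be uncountable. -/
theorem PPerfect.eq_empty {A : Set (ℕ × ℕ)} (hA : P.PPerfect A) {F : Set X} (hF : IsClosed F)
    (hcnt : F.Countable) (hAF : A ⊆ P.code F) : A = ∅ := by
  by_contra hne
  obtain ⟨n₀, hn₀⟩ := nonempty_iff_ne_empty.2 hne
  obtain ⟨x₀, -, hx₀⟩ := hAF hn₀
  obtain ⟨f, rfl⟩ := hcnt.exists_eq_range ⟨x₀, hx₀⟩
  have hstep : ∀ (i : ℕ) (n : A), ∃ m : A, P.prec n m ∧ f i ∉ P.cball m := by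
    rintro i ⟨n, hn⟩
    obtain ⟨u, hu, v, hv, hnu, hnv, huv⟩ := hA n hn
    by_cases h : f i ∈ P.cball u
    · exact ⟨⟨v, hv⟩, hnv, fun h' => (huv ▸ ⟨h, h'⟩ : f i ∈ (∅ : Set X))⟩
    · exact ⟨⟨u, hu⟩, hnu, h⟩
  choose g hg using hstep
  let c : ℕ → A := fun i => Nat.rec ⟨n₀, hn₀⟩ g i
  have hc : ∀ i, P.prec (c i).1 (c (i + 1)).1 := fun i => (hg i (c i)).1
  have hfc : ∀ i, f i ∉ P.cball (c (i + 1)) := fun i => (hg i (c i)).2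
  have hrad : ∀ i, i ≤ (c i).1.2 := fun i =>
    (strictMono_nat_of_lt_succ fun i => (hc i).1 : StrictMono fun i => (c i).1.2).le_apply
  obtain ⟨z, hz⟩ := P.exists_mem_cball_of_prec hc
  have hzF : z ∈ range f := by
    by_contra hzF
    obtain ⟨ε, hε, h⟩ := (P.isOpen_iff _).1 hF.isOpen_compl z hzF
    obtain ⟨N, hN⟩ := exists_half_pow_lt hε
    obtain ⟨y, hy, hyF⟩ := hAF (c N).2
    refine h y ?_ hyF
    have h₁ : P.dist _ _ < _ := hy
    have h₂ : P.dist _ _ ≤ _ := hz N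
    have h₃ := P.dist_triangle y (P.seq (c N).1.1) z
    rw [P.dist_comm (P.seq _) z] at h₃
    have h₄ := hN _ (hrad N)
    rw [pow_succ] at h₁ h₂
    linarith
  obtain ⟨i, rfl⟩ := hzF
  exact hfc i (hz (i + 1))

theorem derivIter_phi_eq_empty {F : Set X} (hF : IsClosed F) (hcnt : F.Countable) :
    P.derivIter (P.code F) (P.phi F) = ∅ := by
  refine PPerfect.eq_empty P (fun n hn => ?_) hF hcnt ?_
  · have h : n ∈ P.derivIter (P.code F) (P.phi F + 1) := by
      rw [phi, P.derivIter_rankA_add_one]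
      exact hn
    rw [P.derivIter_add_one] at h
    exact h.2
  · have := P.derivIter_antitone (P.code F) (zero_le (a := P.phi F))
    rwa [P.derivIter_zero] at this

theorem exists_descendant {A : Set (ℕ × ℕ)} {α : Ordinal.{0}} (m : ℕ) {n : ℕ × ℕ}
    (hn : n ∈ P.derivIter A (α + m)) :
    ∃ u ∈ P.derivIter A α, n.2 + m ≤ u.2 ∧ P.cball u ⊆ P.cball n := by
  induction m generalizing n with
  | zero => exact ⟨n, by simpa using hn, le_rfl, Subset.rfl⟩
  | succ m ih =>
    rw [Nat.cast_succ, ← add_assoc, P.derivIter_add_one] at hn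
    obtain ⟨-, w, hw, -, -, hnw, -, -⟩ := hn
    obtain ⟨u, hu, h₁, h₂⟩ := ih hw
    have := hnw.1
    exact ⟨u, hu, by omega, h₂.trans (hnw.2.trans (P.ball_subset_cball n))⟩

/-- Sequences in disjoint closed balls cannot approach each other too fast. -/
theorem exists_dist_gt_of_apart {u v : ℕ × ℕ} (huv : P.apart u v) {a b : ℕ → X}
    (ha : ∀ i, a i ∈ P.cball u) (hb : ∀ i, b i ∈ P.cball v) (M : ℕ) :
    ∃ m ≥ M, ∃ n ≥ m, 3 * (1 / 2 : ℝ) ^ m < P.dist (a n) (b m) := by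
  by_contra! h
  have hsmall : ∀ ε > 0, ∃ N ≥ M, ∀ n ≥ N, 3 * (1 / 2 : ℝ) ^ n < ε := fun ε hε => by
    obtain ⟨N, hN⟩ := exists_half_pow_lt (show 0 < ε / 3 by positivity)
    refine ⟨max M N, le_max_left _ _, fun n hn => ?_⟩
    have := hN n ((le_max_right _ _).trans hn)
    linarith
  obtain ⟨z, hz⟩ := P.complete a (by
    intro ε hε
    obtain ⟨N, hNM, hN⟩ := hsmall (ε / 2) (by positivity)
    refine ⟨N, fun m hm n hn => ?_⟩
    have h₁ := h N hNM m hm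
    have h₂ := h N hNM n hn
    have h₃ := P.dist_triangle (a m) (b N) (a n)
    rw [P.dist_comm (b N)] at h₃
    have h₄ := hN N le_rfl
    linarith)
  have hzb : ∀ ε > 0, ∃ N, ∀ n ≥ N, P.dist (b n) z < ε := by
    intro ε hε
    obtain ⟨N, hNM, hN⟩ := hsmall (ε / 2) (by positivity)
    obtain ⟨K, hK⟩ := hz (ε / 2) (by positivity)
    refine ⟨max N K, fun n hn => ?_⟩
    have h₁ := h n (hNM.trans ((le_max_left _ _).trans hn)) n le_rfl
    have h₂ := hK n ((le_max_right _ _).trans hn)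
    have h₃ := P.dist_triangle (b n) (a n) z
    rw [P.dist_comm (b n) (a n)] at h₃
    have h₄ := hN n ((le_max_left _ _).trans hn)
    linarith
  have hmem : z ∈ P.cball u ∩ P.cball v :=
    ⟨P.mem_cball_of_tendsto (N := 0) (fun i _ => ha i) hz,
      P.mem_cball_of_tendsto (N := 0) (fun i _ => hb i) hzb⟩
  rw [huv] at hmem
  exact hmem

section Compare

variable (S : Presentation X)

/-- The `S`-ball coded by `s` contains the `P`-ball coded by `p` with room to spare,
as witnessed by the distance of the centres (measured by `P.dist`). -/
def Inside (p s : ℕ × ℕ) : Prop :=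
  P.dist (P.seq p.1) (S.seq s.1) + (1 / 2 : ℝ) ^ (p.2 + 1) < (1 / 2 : ℝ) ^ (s.2 + 1)

variable {P S}

theorem exists_inside (hPS : S.dist = P.dist) {p : ℕ × ℕ} {k : ℕ} (hp : p.2 = k + 1) :
    ∃ s : ℕ × ℕ, s.2 = k ∧ P.Inside S p s := by
  obtain ⟨i, hi⟩ := S.dense (P.seq p.1) ((1 / 2 : ℝ) ^ (p.2 + 1)) (by positivity)
  refine ⟨(i, k), rfl, ?_⟩
  rw [hPS, hp] at hi
  simp only [Inside, hp]
  rw [pow_succ] at hi ⊢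
  linarith

theorem Inside.dist_lt (hPS : S.dist = P.dist) {p s : ℕ × ℕ} {k : ℕ} (hp : p.2 = k + 1)
    (hs : s.2 = k) (h : P.Inside S p s) {x : X} (hx : x ∈ S.cball s) :
    P.dist x (P.seq p.1) < 3 * (1 / 2 : ℝ) ^ (p.2 + 1) := by
  have h₁ : S.dist _ _ ≤ _ := hx
  have h₂ : _ < _ := h
  have h₃ := P.dist_triangle x (S.seq s.1) (P.seq p.1)
  rw [P.dist_comm (S.seq _)] at h₃
  rw [hPS, hs] at h₁
  rw [hs] at h₂
  rw [hp, pow_succ] at h₂ ⊢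
  rw [pow_succ] at h₁ h₂ ⊢
  linarith

/-- The induction behind the comparison of the ranks of two presentations with the same metric. -/
theorem mem_derivIter_of_inside (hPS : S.dist = P.dist) (F : Set X) (α : Ordinal.{0}) :
    ∀ p ∈ P.derivIter (P.code F) (Ordinal.omega0 * α + 1), ∀ s, P.Inside S p s →
      s ∈ S.derivIter (S.code F) α := by
  induction α using Ordinal.limitRecOn with
  | zero =>
    intro p hp s hs
    have hp := P.derivIter_antitone (P.code F) zero_le hp
    rw [P.derivIter_zero] at hp
    rw [S.derivIter_zero]
    obtain ⟨x, hx, hxF⟩ := hp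
    refine ⟨x, ?_, hxF⟩
    have h₁ : P.dist _ _ < _ := hx
    have h₂ : _ < _ := hs
    have h₃ := P.dist_triangle x (P.seq p.1) (S.seq s.1)
    rw [S.mem_ball, hPS]
    linarith
  | limit α hα ih =>
    intro p hp s hs
    rw [S.derivIter_limit _ hα]
    refine mem_iInter.2 fun ⟨β, hβ⟩ => ih β hβ p ?_ s hs
    refine P.derivIter_antitone _ ?_ hp
    gcongr
  | add_one α ih =>
    intro p hp s hs
    have hs' := ih p (P.derivIter_antitone _ (by gcongr; exact Order.le_succ α) hp) s hs
    rw [P.derivIter_add_one] at hp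
    obtain ⟨-, u, hu, v, hv, hpu, hpv, huv⟩ := hp
    have hdesc : ∀ w ∈ P.derivIter (P.code F) (Ordinal.omega0 * (α + 1)), ∀ m : ℕ,
        ∃ t ∈ P.derivIter (P.code F) (Ordinal.omega0 * α + 1),
          m ≤ t.2 ∧ P.cball t ⊆ P.cball w := fun w hw m => by
      suffices h : w ∈ P.derivIter (P.code F) (Ordinal.omega0 * α + 1 + m) by
        obtain ⟨t, ht, h₁, h₂⟩ := P.exists_descendant m h
        exact ⟨t, ht, by omega, h₂⟩
      refine P.derivIter_antitone _ ?_ hw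
      rw [mul_add_one, add_assoc]
      gcongr
      exact_mod_cast (Ordinal.natCast_lt_omega0 (1 + m)).le
    choose a ha hau haw using hdesc u hu
    choose b hb hbv hbw using hdesc v hv
    have hgap : 0 < (1 / 2 : ℝ) ^ (s.2 + 1) - (1 / 2 : ℝ) ^ (p.2 + 1) -
        P.dist (P.seq p.1) (S.seq s.1) := by
      have : _ < _ := hs
      linarith
    obtain ⟨N, hN⟩ := exists_half_pow_lt (show 0 < _ / 3 from div_pos hgap three_pos)
    obtain ⟨m, hm, n, hn, hmn⟩ := P.exists_dist_gt_of_apart huv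
      (fun i => haw i (P.seq_mem_cball _)) (fun i => hbw i (P.seq_mem_cball _)) (N + s.2 + 2)
    have hkey : ∀ t ∈ P.derivIter (P.code F) (Ordinal.omega0 * α + 1), m ≤ t.2 →
        P.seq t.1 ∈ P.ball p → ∃ r ∈ S.derivIter (S.code F) α, S.prec s r ∧
          ∀ x ∈ S.cball r, P.dist x (P.seq t.1) < 3 / 2 * (1 / 2 : ℝ) ^ m := by
      intro t ht htm htp
      obtain ⟨k, hk⟩ : ∃ k, t.2 = k + 1 := ⟨t.2 - 1, by omega⟩
      obtain ⟨r, hr, hin⟩ := exists_inside hPS hk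
      have hrad : (1 / 2 : ℝ) ^ (t.2 + 1) ≤ (1 / 2 : ℝ) ^ m / 2 := by
        rw [pow_succ]
        have := pow_le_pow_of_le_one (by norm_num : (0 : ℝ) ≤ 1 / 2) (by norm_num) htm
        linarith
      have hclose : ∀ x ∈ S.cball r, P.dist x (P.seq t.1) < 3 / 2 * (1 / 2 : ℝ) ^ m :=
        fun x hx => by
          have := hin.dist_lt hPS hk hr hx
          linarith
      refine ⟨r, ih t ht r hin, ⟨by omega, fun x hx => ?_⟩, hclose⟩
      have h₁ := hclose x hx
      have h₂ : P.dist _ _ < _ := htp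
      have h₃ := P.dist_triangle x (P.seq t.1) (S.seq s.1)
      have h₄ := P.dist_triangle (P.seq t.1) (P.seq p.1) (S.seq s.1)
      have h₅ := hN m (by omega)
      have h₆ : (0 : ℝ) < (1 / 2) ^ m := by positivity
      rw [S.mem_ball, hPS]
      linarith
    obtain ⟨r₁, hr₁, hsr₁, hd₁⟩ := hkey (a n) (ha n) (hn.trans (hau n))
      (hpu.2 (haw n (P.seq_mem_cball _)))
    obtain ⟨r₂, hr₂, hsr₂, hd₂⟩ := hkey (b m) (hb m) (hbv m)
      (hpv.2 (hbw m (P.seq_mem_cball _)))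
    rw [S.derivIter_add_one]
    refine ⟨hs', r₁, hr₁, r₂, hr₂, hsr₁, hsr₂, ?_⟩
    refine eq_empty_of_forall_notMem fun x hx => ?_
    have h₁ := hd₁ x hx.1
    have h₂ := hd₂ x hx.2
    have h₃ := P.dist_triangle (P.seq (a n).1) x (P.seq (b m).1)
    rw [P.dist_comm _ x] at h₃
    linarith

end Compare

end Presentation

/-- Any two presentations with the same metric satisfy
`φ_P(F) ≤ ω·φ_S(F) + 2` on countable closed sets. -/
theorem stmt12 {X : Type} [TopologicalSpace X] [PolishSpace X]
    (P S : Presentation X) (hPS : S.dist = P.dist)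
    (F : Set X) (hF : IsClosed F) (hcnt : F.Countable) :
    P.phi F ≤ Ordinal.omega0 * S.phi F + 2 := by
  refine P.rankA_le_of_derivIter_eq_empty (eq_empty_of_forall_notMem fun p hp => ?_)
  rw [← one_add_one_eq_two, ← add_assoc, P.derivIter_add_one] at hp
  obtain ⟨-, u, hu, -, -, hpu, -, -⟩ := hp
  obtain ⟨k, hk⟩ : ∃ k, u.2 = k + 1 := ⟨u.2 - 1, by have := hpu.1; omega⟩
  obtain ⟨s, -, hs⟩ := Presentation.exists_inside hPS hk
  have := Presentation.mem_derivIter_of_inside hPS F _ u hu s hs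
  rw [S.derivIter_phi_eq_empty hF hcnt] at this
  exact this
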